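/- arXiv:2007.03845 — 3 statements merged into one kernel-verified Lean document; each statement's English description precedes it below -/
import Mathlib

section
/- Let K be a field, V a finite-dimensional K-vector space, T a K-linear endomorphism of V, n a natural number, and σ ∈ S_n. Then Tr(L_σ^{(n)} ∘ T^{⊗n}) = (∏_{k ∈ cycleType(σ)} Tr(T^k)) · Tr(T)^{n − Σ cycleType(σ)}, where cycleType(σ) is the multiset of lengths (all ≥ 2) of the nontrivial cycles of σ, so that n − Σ cycleType(σ) is the number of fixed points of σ. -/
open scoped TensorProduct

/-- The endomorphism `L_σ^{(n)}` of the `n`-th tensor power of `V`, determined by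
`v_1 ⊗ ⋯ ⊗ v_n ↦ v_{σ⁻¹(1)} ⊗ ⋯ ⊗ v_{σ⁻¹(n)}`. -/
noncomputable def permMap (K : Type*) [Field K] (V : Type*) [AddCommGroup V] [Module K V]
    (n : ℕ) (σ : Equiv.Perm (Fin n)) :
    (⨂[K] _ : Fin n, V) →ₗ[K] ⨂[K] _ : Fin n, V :=
  (PiTensorProduct.reindex K (fun _ : Fin n => V) σ).toLinearMap

/-- The endomorphism `T^{⊗n}` of the `n`-th tensor power of `V` induced by `T : V →ₗ[K] V`. -/
noncomputable def tpowMap (K : Type*) [Field K] (V : Type*) [AddCommGroup V] [Module K V]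
    (n : ℕ) (T : V →ₗ[K] V) :
    (⨂[K] _ : Fin n, V) →ₗ[K] ⨂[K] _ : Fin n, V :=
  PiTensorProduct.map fun _ => T

/-- The cyclic sum attached to a permutation and a matrix. -/
def cycSum {K : Type*} [Field K] {κ : Type*} [Fintype κ]
    (A : Matrix κ κ K) {α : Type*} [Fintype α] [DecidableEq α] (σ : Equiv.Perm α) : K :=
  ∑ f : α → κ, ∏ i, A (f i) (f (σ i))

section
variable {K : Type*} [Field K] {κ : Type*} [Fintype κ] [DecidableEq κ] (A : Matrix κ κ K)

theorem path_sum (k : ℕ) : ∀ a b : κ, (A ^ (k+1)) a b =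
    ∑ f : Fin k → κ, ∏ i : Fin (k+1),
      A (Fin.cons (α := fun _ => κ) a f i) (Fin.snoc (α := fun _ => κ) f b i) := by
  induction k with
  | zero =>
    intro a b
    simp [Fin.snoc]
  | succ k ih =>
    intro a b
    rw [pow_succ', Matrix.mul_apply, ← (Fin.consEquiv (fun _ => κ)).sum_comp,
      Fintype.sum_prod_type]
    refine Finset.sum_congr rfl fun c _ => ?_
    rw [ih, Finset.mul_sum]
    refine Finset.sum_congr rfl fun g _ => ?_
    rw [Fin.prod_univ_succ (n := k+1)]
    simp [Fin.consEquiv, ← Fin.cons_snoc_eq_snoc_cons]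

theorem cycSum_finRotate (k : ℕ) : cycSum A (finRotate (k+1)) = (A ^ (k+1)).trace := by
  rw [cycSum, Matrix.trace, ← (Fin.consEquiv (fun _ => κ)).sum_comp,
      Fintype.sum_prod_type]
  refine Finset.sum_congr rfl fun a _ => ?_
  rw [Matrix.diag_apply, path_sum]
  refine Finset.sum_congr rfl fun g _ => ?_
  refine Finset.prod_congr rfl fun i _ => ?_
  rw [Fin.snoc_eq_cons_rotate]
  rfl

theorem cycSum_congr {α β : Type*} [Fintype α] [DecidableEq α] [Fintype β] [DecidableEq β]
    (σ : Equiv.Perm α) (τ : Equiv.Perm β) (e : α ≃ β) (h : ∀ x, e (σ x) = τ (e x)) :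
    cycSum A σ = cycSum A τ := by
  rw [cycSum, cycSum, ← (e.arrowCongr (Equiv.refl κ)).sum_comp]
  refine Finset.sum_congr rfl fun f _ => ?_
  rw [← e.prod_comp]
  simp [← h]

theorem cycSum_one {α : Type*} [Fintype α] [DecidableEq α] :
    cycSum A (1 : Equiv.Perm α) = A.trace ^ Fintype.card α := by
  simp only [cycSum, Equiv.Perm.one_apply, Matrix.trace, Matrix.diag_apply]
  rw [← Finset.card_univ, ← Finset.prod_const, Finset.prod_univ_sum]
  simp

theorem cycSum_split {α : Type*} [Fintype α] [DecidableEq α] (σ : Equiv.Perm α)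
    (p : α → Prop) [DecidablePred p] (h : ∀ x, p (σ x) ↔ p x) (h' : ∀ x, ¬ p (σ x) ↔ ¬ p x) :
    cycSum A σ = cycSum A (σ.subtypePerm h) *
      cycSum A (σ.subtypePerm (p := fun x => ¬ p x) h') := by
  rw [cycSum, cycSum, cycSum, Finset.sum_mul_sum, ← Fintype.sum_prod_type',
    ← (Equiv.piEquivPiSubtypeProd p (fun _ => κ)).sum_comp]
  refine Finset.sum_congr rfl fun f _ => ?_
  rw [← Fintype.prod_subtype_mul_prod_subtype p]
  rfl

theorem cycSum_cycle {α : Type*} [Fintype α] [DecidableEq α] (σ : Equiv.Perm α)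
    (h : σ.cycleType = {Fintype.card α}) :
    cycSum A σ = (A ^ Fintype.card α).trace := by
  have h2 : 2 ≤ Fintype.card α := Equiv.Perm.two_le_of_mem_cycleType (σ := σ) (by simp [h])
  obtain ⟨k, hk⟩ : ∃ k, Fintype.card α = k + 2 := ⟨_, (Nat.sub_add_cancel h2).symm⟩
  rw [hk] at h ⊢
  let e : α ≃ Fin (k+2) := Fintype.equivFinOfCardEq hk
  let τ : Equiv.Perm (Fin (k+2)) := e.permCongr σ
  have hτ : τ.cycleType = {k+2} := by
    have := Equiv.Perm.cycleType_extendDomain (p := fun _ : Fin (k+2) => True)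
      (e.trans (Equiv.Set.univ _).symm) (g := σ)
    rw [← h, ← this]
    congr 1
  have hc : IsConj τ (finRotate (k+2)) := by
    rw [Equiv.Perm.isConj_iff_cycleType_eq, hτ, cycleType_finRotate]
  obtain ⟨c, hc⟩ := isConj_iff.1 hc
  rw [← cycSum_finRotate A (k+1)]
  refine cycSum_congr A σ _ (e.trans c) fun x => ?_
  rw [← hc]
  simp [τ]

theorem cycSum_eq (N : ℕ) : ∀ (α : Type) [Fintype α] [DecidableEq α] (σ : Equiv.Perm α),
    Fintype.card α = N →
    cycSum A σ = (σ.cycleType.map fun k => (A ^ k).trace).prod *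
      A.trace ^ (N - σ.cycleType.sum) := by
  induction N using Nat.strong_induction_on with
  | _ N ih =>
  intro α _ _ σ hN
  by_cases h1 : σ = 1
  · subst h1; simp [cycSum_one, hN]
  obtain ⟨x, hx⟩ : ∃ x, σ x ≠ x := by
    by_contra! H
    exact h1 (Equiv.ext H)
  let c := σ.cycleOf x
  have hcyc : c.IsCycle := Equiv.Perm.isCycle_cycleOf σ hx
  have hp : ∀ y, y ∈ c.support ↔ σ.SameCycle x y := fun y => by
    rw [Equiv.Perm.mem_support_cycleOf_iff' hx]
  obtain ⟨p, hpc⟩ : ∃ p : α → Prop, ∀ y, p y ↔ y ∈ c.support := ⟨_, fun _ => Iff.rfl⟩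
  have : DecidablePred p := Classical.decPred p
  have h : ∀ y, p (σ y) ↔ p y := fun y => by
    rw [hpc, hpc, hp, hp, Equiv.Perm.sameCycle_apply_right]
  have h' : ∀ y, ¬ p (σ y) ↔ ¬ p y := fun y => not_congr (h y)
  rw [cycSum_split A σ p h h']
  set s1 := σ.subtypePerm h with hs1
  set s2 := σ.subtypePerm (p := fun y => ¬ p y) h' with hs2
  have e1 : Equiv.Perm.ofSubtype s1 = c := by
    ext y
    by_cases hy : p y
    · rw [Equiv.Perm.ofSubtype_apply_of_mem s1 hy]
      simp [s1, c, ((hp y).1 ((hpc y).1 hy)).cycleOf_apply]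
    · rw [Equiv.Perm.ofSubtype_apply_of_not_mem s1 hy]
      rw [hpc, Equiv.Perm.notMem_support] at hy
      exact hy.symm
  have hcard1 : Fintype.card {y // p y} = c.support.card := by
    rw [Fintype.card_subtype]
    congr 1
    ext y
    rw [Finset.mem_filter, hpc]
    simp
  have t1 : s1.cycleType = {Fintype.card {y // p y}} := by
    rw [← Equiv.Perm.cycleType_ofSubtype, e1, hcyc.cycleType, hcard1]
  have e2 : σ = c * Equiv.Perm.ofSubtype s2 := by
    rw [← e1]
    ext y
    by_cases hy : p y
    · rw [Equiv.Perm.mul_apply, Equiv.Perm.ofSubtype_apply_of_not_mem s2 (not_not.2 hy),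
        Equiv.Perm.ofSubtype_apply_of_mem s1 hy]
      simp [s1]
    · rw [Equiv.Perm.mul_apply, Equiv.Perm.ofSubtype_apply_of_mem s2 hy]
      exact (Equiv.Perm.ofSubtype_apply_of_not_mem s1 ((h' y).2 hy)).symm
  have hd : c.Disjoint (Equiv.Perm.ofSubtype s2) := by
    intro y
    by_cases hy : p y
    · right
      exact Equiv.Perm.ofSubtype_apply_of_not_mem s2 (not_not.2 hy)
    · left
      rwa [hpc, Equiv.Perm.notMem_support] at hy
  have t : σ.cycleType = {c.support.card} + s2.cycleType := by
    conv_lhs => rw [e2]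
    rw [hd.cycleType_mul, Equiv.Perm.cycleType_ofSubtype, hcyc.cycleType]
  have hcard : Fintype.card {y // ¬ p y} = N - c.support.card := by
    rw [Fintype.card_subtype_compl, hN, hcard1]
  have hpos := hcyc.two_le_card_support
  have hle : c.support.card ≤ N := hN ▸ Finset.card_le_univ _
  rw [cycSum_cycle A s1 t1, ih (N - c.support.card) (by omega) _ s2 hcard, t, hcard1]
  simp [mul_assoc, Nat.sub_sub]

end

/-- `Tr(L_σ^{(n)} ∘ T^{⊗n})` equals the product over the cycle type of `σ` of
the traces `Tr(T^k)`, times `Tr(T)` to the power of the number of fixed points of `σ`. -/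
theorem stmt7 (K : Type*) [Field K] (V : Type*) [AddCommGroup V] [Module K V]
    [FiniteDimensional K V] (T : V →ₗ[K] V) (n : ℕ) (σ : Equiv.Perm (Fin n)) :
    LinearMap.trace K (⨂[K] _ : Fin n, V) (permMap K V n σ ∘ₗ tpowMap K V n T) =
      (σ.cycleType.map fun k => LinearMap.trace K V (T ^ k)).prod *
        LinearMap.trace K V T ^ (n - σ.cycleType.sum) := by
  classical
  let b := Module.finBasis K V
  let B := Basis.piTensorProduct (fun _ : Fin n => b)
  have key := cycSum_eq (LinearMap.toMatrix b b T) n (Fin n) σ⁻¹ (Fintype.card_fin n)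
  have htr : ∀ k, (LinearMap.toMatrix b b T ^ k).trace = LinearMap.trace K V (T ^ k) := by
    intro k
    rw [LinearMap.toMatrix_pow, LinearMap.trace_eq_matrix_trace K b]
  have htr1 := htr 1
  rw [pow_one, pow_one] at htr1
  simp only [htr, htr1, Equiv.Perm.cycleType_inv] at key
  rw [← key, LinearMap.trace_eq_matrix_trace K B, cycSum, Matrix.trace]
  refine Finset.sum_congr rfl fun f _ => ?_
  rw [Matrix.diag_apply, LinearMap.toMatrix_apply]
  simp only [B, Basis.piTensorProduct_apply, permMap, tpowMap, LinearMap.comp_apply,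
    PiTensorProduct.map_tprod, LinearEquiv.coe_coe, PiTensorProduct.reindex_tprod,
    Basis.piTensorProduct_repr_tprod_apply, LinearMap.toMatrix_apply]
  rfl
end

section
/- Let K be an algebraically closed field of characteristic zero and d ≥ 1. Let R = K[x_{ij} : 1 ≤ i,j ≤ d] be the polynomial ring in the entries of a generic d × d matrix, and for each k ≥ 1 let t_k ∈ R be the polynomial whose value at any matrix A ∈ M_d(K) is Tr(A^k). Then a polynomial f ∈ R satisfies f(gAg⁻¹) = f(A) for every g ∈ GL_d(K) and every A ∈ M_d(K) if and only if f lies in the K-subalgebra of R generated by t_1, t_2, …, t_d. -/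
/-- The generic `d × d` matrix whose entries are the variables `x_{ij}`. -/
noncomputable def genericMatrix (K : Type*) [Field K] (d : ℕ) :
    Matrix (Fin d) (Fin d) (MvPolynomial (Fin d × Fin d) K) :=
  Matrix.of fun i j => MvPolynomial.X (i, j)

open MvPolynomial in
lemma esymm_mem_adjoin_psum (K : Type*) [Field K] [CharZero K] (d k : ℕ) (hk : k ≤ d) :
    esymm (Fin d) K k ∈ Algebra.adjoin K ((fun k : ℕ => psum (Fin d) K k) '' Set.Icc 1 d) := by
  induction k using Nat.strong_induction_on with
  | _ k ih =>
    rcases Nat.eq_zero_or_pos k with rfl | hpos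
    · simp only [esymm_zero]; exact one_mem _
    have h := mul_esymm_eq_sum (Fin d) K k
    have hk0 : (k : K) ≠ 0 := by exact_mod_cast hpos.ne'
    have h2 : esymm (Fin d) K k = (k : K)⁻¹ • ((k : MvPolynomial (Fin d) K) * esymm (Fin d) K k) := by
      rw [← nsmul_eq_mul, ← Nat.cast_smul_eq_nsmul K, smul_smul, inv_mul_cancel₀ hk0, one_smul]
    rw [h2, h]
    refine Subalgebra.smul_mem _ (mul_mem (pow_mem (neg_mem (one_mem _)) _) (sum_mem ?_)) _
    intro a ha
    rw [Finset.mem_filter] at ha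
    have ha1 := Finset.HasAntidiagonal.mem_antidiagonal.mp ha.1
    have ha2 := ha.2
    refine mul_mem (mul_mem (pow_mem (neg_mem (one_mem _)) _) (ih a.1 ha.2 (by omega))) ?_
    exact Algebra.subset_adjoin ⟨a.2, ⟨by omega, by omega⟩, rfl⟩

open MvPolynomial in
lemma symm_mem_adjoin_psum (K : Type*) [Field K] [CharZero K] (d : ℕ)
    (p : MvPolynomial (Fin d) K) (hp : p.IsSymmetric) :
    p ∈ Algebra.adjoin K ((fun k : ℕ => psum (Fin d) K k) '' Set.Icc 1 d) := by
  obtain ⟨q, hq⟩ := (esymmAlgHom_fin_bijective K d).2 ⟨p, hp⟩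
  have h : p = aeval (fun i : Fin d => esymm (Fin d) K (i + 1)) q := by
    rw [← esymmAlgHom_apply, hq]
  rw [h]
  refine Algebra.adjoin_le ?_ (aeval_range (R := K) (fun i : Fin d => esymm (Fin d) K (i + 1)) ▸
    AlgHom.mem_range_self _ q)
  rintro _ ⟨i, rfl⟩
  exact esymm_mem_adjoin_psum K d _ (by omega)

lemma exists_diag (K : Type*) [Field K] [IsAlgClosed K] (d : ℕ)
    (A : Matrix (Fin d) (Fin d) K) (hA : A.charpoly.Separable) :
    ∃ (g : GL (Fin d) K) (v : Fin d → K),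
      A = (g : Matrix (Fin d) (Fin d) K) * Matrix.diagonal v *
        ((g⁻¹ : GL (Fin d) K) : Matrix (Fin d) (Fin d) K) := by
  classical
  have hc : A.charpoly.roots.toFinset.card = d := by
    rw [Multiset.toFinset_card_of_nodup (Polynomial.nodup_roots hA),
      IsAlgClosed.card_roots_eq_natDegree, A.charpoly_natDegree_eq_dim, Fintype.card_fin]
  let e := (Finset.equivFinOfCardEq hc).symm
  have hroot : ∀ i, ∃ w : Fin d → K,
      Module.End.HasEigenvector (Matrix.toLin' A) (e i : K) w := by
    intro i
    apply Module.End.HasEigenvalue.exists_hasEigenvector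
    rw [Module.End.hasEigenvalue_iff_mem_spectrum, Matrix.spectrum_toLin',
      Matrix.mem_spectrum_iff_isRoot_charpoly]
    have := (e i).2
    rw [Multiset.mem_toFinset] at this
    exact Polynomial.isRoot_of_mem_roots this
  choose w hw using hroot
  have hli := Module.End.eigenvectors_linearIndependent' (Matrix.toLin' A) (fun i => (e i : K))
    (Subtype.coe_injective.comp e.injective) w hw
  let P : Matrix (Fin d) (Fin d) K := (Matrix.of w).transpose
  have hP : IsUnit P := by
    rw [← Matrix.linearIndependent_cols_iff_isUnit]
    exact hli
  have hAP : A * P = P * Matrix.diagonal (fun i => (e i : K)) := by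
    ext i j
    rw [Matrix.mul_diagonal]
    have := congrFun (hw j).apply_eq_smul i
    rw [Matrix.toLin'_apply] at this
    simpa [P, Matrix.mul_apply, Matrix.mulVec, dotProduct, mul_comm] using this
  refine ⟨hP.unit, fun i => (e i : K), ?_⟩
  rw [IsUnit.unit_spec, ← hAP, Matrix.mul_assoc]
  have : P * ((hP.unit⁻¹ : GL (Fin d) K) : Matrix (Fin d) (Fin d) K) = 1 := by
    have := hP.unit.mul_inv
    rwa [IsUnit.unit_spec] at this
  rw [this, mul_one]

lemma eval_map_genericMatrix (K : Type*) [Field K] (d : ℕ) (S : Type*) [CommRing S] [Algebra K S]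
    (A : Matrix (Fin d) (Fin d) S) :
    (genericMatrix K d).map (MvPolynomial.aeval (fun p : Fin d × Fin d => A p.1 p.2)) = A := by
  ext i j
  simp [genericMatrix]

lemma aeval_trace (K : Type*) [Field K] (d : ℕ) (S : Type*) [CommRing S] [Algebra K S]
    (A : Matrix (Fin d) (Fin d) S) (k : ℕ) :
    MvPolynomial.aeval (fun p : Fin d × Fin d => A p.1 p.2)
      (Matrix.trace (genericMatrix K d ^ k)) = Matrix.trace (A ^ k) := by
  have h := AddMonoidHom.map_trace
    (MvPolynomial.aeval (R := K) (fun p : Fin d × Fin d => A p.1 p.2)) (genericMatrix K d ^ k)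
  rw [h, ← AlgHom.mapMatrix_apply, map_pow, AlgHom.mapMatrix_apply, eval_map_genericMatrix]

lemma invariant_of_mem (K : Type*) [Field K] (d : ℕ)
    (f : MvPolynomial (Fin d × Fin d) K)
    (hf : f ∈ Algebra.adjoin K
        ((fun k : ℕ => Matrix.trace (genericMatrix K d ^ k)) '' Set.Icc 1 d))
    (g : GL (Fin d) K) (A : Matrix (Fin d) (Fin d) K) :
    MvPolynomial.aeval (R := K)
            (fun p => ((g : Matrix (Fin d) (Fin d) K) * A *
              ((g⁻¹ : GL (Fin d) K) : Matrix (Fin d) (Fin d) K)) p.1 p.2) f =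
          MvPolynomial.aeval (R := K) (fun p => A p.1 p.2) f := by
  induction hf using Algebra.adjoin_induction with
  | mem x hx =>
    obtain ⟨k, -, rfl⟩ := hx
    simp only
    rw [aeval_trace, aeval_trace, Units.conj_pow, Matrix.trace_mul_cycle, Units.inv_mul, one_mul]
  | algebraMap r => simp
  | add x y _ _ hx hy => simp only [map_add, hx, hy]
  | mul x y _ _ hx hy => simp only [map_mul, hx, hy]

lemma exists_discr (K : Type*) [Field K] [CharZero K] (d : ℕ) (hd : 1 ≤ d) :
    ∃ D : MvPolynomial (Fin d × Fin d) K, D ≠ 0 ∧ ∀ A : Matrix (Fin d) (Fin d) K,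
      MvPolynomial.aeval (R := K) (fun p => A p.1 p.2) D ≠ 0 → A.charpoly.Separable := by
  let D := Polynomial.resultant (genericMatrix K d).charpoly
    (Polynomial.derivative (genericMatrix K d).charpoly) d (d - 1)
  have key : ∀ A : Matrix (Fin d) (Fin d) K,
      MvPolynomial.aeval (R := K) (fun p => A p.1 p.2) D =
        Polynomial.resultant A.charpoly (Polynomial.derivative A.charpoly) := by
    intro A
    have h1 : A.charpoly.natDegree = d := by simp
    have h2 : (Polynomial.derivative A.charpoly).natDegree = d - 1 := by
      rw [Polynomial.natDegree_derivative, h1]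
    rw [h1, h2]
    have h3 : (genericMatrix K d).charpoly.map
        (MvPolynomial.aeval (R := K) (fun p : Fin d × Fin d => A p.1 p.2) :
          MvPolynomial (Fin d × Fin d) K →ₐ[K] K).toRingHom = A.charpoly := by
      rw [← Matrix.charpoly_map]
      congr 1
      exact eval_map_genericMatrix K d K A
    have h4 := Polynomial.resultant_map_map (genericMatrix K d).charpoly
      (Polynomial.derivative (genericMatrix K d).charpoly) d (d - 1)
      (MvPolynomial.aeval (R := K) (fun p : Fin d × Fin d => A p.1 p.2) :
          MvPolynomial (Fin d × Fin d) K →ₐ[K] K).toRingHom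
    rw [← Polynomial.derivative_map, h3] at h4
    exact h4.symm
  refine ⟨D, ?_, ?_⟩
  · intro h0
    have h := key (Matrix.diagonal (fun i : Fin d => (i : K)))
    rw [h0, map_zero] at h
    refine Polynomial.resultant_ne_zero _ _ ?_ h.symm
    have : (Matrix.diagonal (fun i : Fin d => ((i : ℕ) : K))).charpoly.Separable := by
      rw [Matrix.charpoly_diagonal]
      exact Polynomial.separable_prod_X_sub_C_iff.mpr
        (Nat.cast_injective.comp Fin.val_injective)
    exact this
  · intro A hA
    rw [key] at hA
    by_contra hns
    apply hA
    rw [Polynomial.resultant_eq_zero_iff]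
    exact ⟨Or.inl A.charpoly_monic.ne_zero, hns⟩

/-- a polynomial `f` in the entries of a generic `d × d` matrix is invariant
under conjugation, i.e. `f(gAg⁻¹) = f(A)` for all `g ∈ GL_d(K)` and `A ∈ M_d(K)`, if and
only if `f` lies in the subalgebra generated by the trace polynomials
`t_k = Tr(X^k)`, `1 ≤ k ≤ d`. -/
theorem stmt15 (K : Type*) [Field K] [IsAlgClosed K] [CharZero K] (d : ℕ) (hd : 1 ≤ d)
    (f : MvPolynomial (Fin d × Fin d) K) :
    (∀ (g : GL (Fin d) K) (A : Matrix (Fin d) (Fin d) K),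
        MvPolynomial.eval
            (fun p => ((g : Matrix (Fin d) (Fin d) K) * A *
              ((g⁻¹ : GL (Fin d) K) : Matrix (Fin d) (Fin d) K)) p.1 p.2) f =
          MvPolynomial.eval (fun p => A p.1 p.2) f) ↔
      f ∈ Algebra.adjoin K
        ((fun k : ℕ => Matrix.trace (genericMatrix K d ^ k)) '' Set.Icc 1 d) := by
  classical
  constructor
  · intro hf
    let φ : MvPolynomial (Fin d × Fin d) K →ₐ[K] MvPolynomial (Fin d) K :=
      MvPolynomial.aeval (fun p => Matrix.diagonal
        (fun i : Fin d => (MvPolynomial.X i : MvPolynomial (Fin d) K)) p.1 p.2)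
    have hφt : ∀ k, φ (Matrix.trace (genericMatrix K d ^ k)) = MvPolynomial.psum (Fin d) K k := by
      intro k
      rw [aeval_trace, Matrix.diagonal_pow, Matrix.trace_diagonal]
      simp [MvPolynomial.psum]
    have hφe : ∀ (v : Fin d → K) (q : MvPolynomial (Fin d × Fin d) K),
        MvPolynomial.aeval (R := K) v (φ q) =
          MvPolynomial.aeval (R := K) (fun p => Matrix.diagonal v p.1 p.2) q := by
      intro v q
      rw [← AlgHom.comp_apply]
      congr 1
      apply MvPolynomial.algHom_ext
      intro p
      simp only [AlgHom.comp_apply, φ, MvPolynomial.aeval_X, Matrix.diagonal_apply]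
      split_ifs <;> simp
    have hf' : ∀ (g : GL (Fin d) K) (A : Matrix (Fin d) (Fin d) K),
        MvPolynomial.aeval (R := K) (fun p => ((g : Matrix (Fin d) (Fin d) K) * A *
              ((g⁻¹ : GL (Fin d) K) : Matrix (Fin d) (Fin d) K)) p.1 p.2) f =
          MvPolynomial.aeval (R := K) (fun p => A p.1 p.2) f := by
      intro g A
      simpa only [MvPolynomial.aeval_eq_eval] using hf g A
    have hsym : (φ f).IsSymmetric := by
      intro σ
      apply MvPolynomial.funext
      intro v
      rw [MvPolynomial.eval_rename]
      simp only [← MvPolynomial.coe_aeval_eq_eval, RingHom.coe_coe]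
      rw [hφe, hφe]
      let g : GL (Fin d) K :=
        ⟨σ.permMatrix K, σ⁻¹.permMatrix K, by
          rw [← Matrix.permMatrix_mul]; simp, by rw [← Matrix.permMatrix_mul]; simp⟩
      rw [← hf' g (Matrix.diagonal v)]
      congr 2
      have : (g : Matrix (Fin d) (Fin d) K) * Matrix.diagonal v *
          ((g⁻¹ : GL (Fin d) K) : Matrix (Fin d) (Fin d) K) = Matrix.diagonal (v ∘ σ) := by
        change σ.permMatrix K * Matrix.diagonal v * (σ⁻¹).permMatrix K = _
        rw [Equiv.Perm.permMatrix, Equiv.Perm.permMatrix, PEquiv.toMatrix_toPEquiv_mul,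
          PEquiv.mul_toMatrix_toPEquiv]
        ext i j
        have hs : (Equiv.symm σ⁻¹) j = σ j := rfl
        simp [Matrix.diagonal_apply, hs]
      rw [this]
    have hmem := symm_mem_adjoin_psum K d (φ f) hsym
    have himg : (fun k : ℕ => MvPolynomial.psum (Fin d) K k) '' Set.Icc 1 d =
        φ '' ((fun k : ℕ => Matrix.trace (genericMatrix K d ^ k)) '' Set.Icc 1 d) := by
      rw [Set.image_image]
      simp only [hφt]
    rw [himg, ← AlgHom.map_adjoin] at hmem
    obtain ⟨h, hh, hhf⟩ := hmem
    have hhf : φ h = φ f := hhf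
    obtain ⟨D, hD0, hD⟩ := exists_discr K d hd
    have hz : (f - h) * D = 0 := by
      apply MvPolynomial.funext
      intro x
      let A : Matrix (Fin d) (Fin d) K := Matrix.of fun i j => x (i, j)
      have hx : x = fun p => A p.1 p.2 := by ext p; simp [A]
      rw [hx]
      simp only [← MvPolynomial.coe_aeval_eq_eval, RingHom.coe_coe, map_mul, map_sub, map_zero]
      by_cases hDA : MvPolynomial.aeval (R := K) (fun p => A p.1 p.2) D = 0
      · rw [hDA, mul_zero]
      · obtain ⟨g, v, hA⟩ := exists_diag K d A (hD A hDA)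
        rw [hA, hf', invariant_of_mem K d h hh, ← hφe, ← hφe, hhf, sub_self, zero_mul]
    rcases mul_eq_zero.mp hz with h0 | h0
    · rw [sub_eq_zero.mp h0]; exact hh
    · exact absurd h0 hD0
  · intro hf g A
    have := invariant_of_mem K d f hf g A
    simpa only [MvPolynomial.aeval_eq_eval] using this
end

section
/- Let K be a field of characteristic zero and let n ≤ d be natural numbers with n ≥ 1. In the K-vector space of all functions from End_K(K^d) to K, the span of the set of functions {A ↦ Tr(L_σ^{(n)} ∘ A^{⊗n}) : σ ∈ S_n} has dimension equal to the number of partitions of n. -/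
open scoped TensorProduct

section Aux

theorem aux_trace (K : Type*) [Field K] (n d : ℕ) (σ : Equiv.Perm (Fin n))
    (A : (Fin d → K) →ₗ[K] (Fin d → K)) :
    LinearMap.trace K (⨂[K] _ : Fin n, (Fin d → K))
      (permMap K (Fin d → K) n σ ∘ₗ tpowMap K (Fin d → K) n A) =
    ∑ i : Fin n → Fin d, ∏ k, LinearMap.toMatrix' A (i (σ k)) (i k) := by
  classical
  rw [LinearMap.trace_eq_matrix_trace K
    (Basis.piTensorProduct (fun _ : Fin n => Pi.basisFun K (Fin d))), Matrix.trace]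
  refine Finset.sum_congr rfl fun i _ => ?_
  rw [Matrix.diag_apply, LinearMap.toMatrix_apply, Basis.piTensorProduct_apply,
    LinearMap.comp_apply, tpowMap, permMap, PiTensorProduct.map_tprod, LinearEquiv.coe_coe,
    PiTensorProduct.reindex_tprod, Basis.piTensorProduct_repr_tprod_apply,
    ← Equiv.prod_comp σ]
  refine Finset.prod_congr rfl fun k _ => ?_
  simp [LinearMap.toMatrix'_apply]

theorem aux_conj (K : Type*) [Field K] (n d : ℕ) (σ τ : Equiv.Perm (Fin n)) (h : IsConj σ τ)
    (M : Matrix (Fin d) (Fin d) K) :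
    ∑ i : Fin n → Fin d, ∏ k, M (i (σ k)) (i k) =
      ∑ i : Fin n → Fin d, ∏ k, M (i (τ k)) (i k) := by
  obtain ⟨c, rfl⟩ := isConj_iff.1 h
  rw [← Equiv.sum_comp (Equiv.arrowCongr c.symm (Equiv.refl (Fin d)))]
  refine Finset.sum_congr rfl fun i _ => ?_
  rw [← Equiv.prod_comp c.symm]
  simp

theorem aux_filter_inj (n : ℕ) (p q : Nat.Partition n)
    (h : p.parts.filter (fun a => 2 ≤ a) = q.parts.filter (fun a => 2 ≤ a)) : p = q := by
  have key : ∀ p : Nat.Partition n, p.parts = p.parts.filter (fun a => 2 ≤ a) +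
      Multiset.replicate (n - (p.parts.filter (fun a => 2 ≤ a)).sum) 1 := by
    intro p
    have h1 := Multiset.filter_add_not (fun a => 2 ≤ a) p.parts
    have h2 : p.parts.filter (fun a => ¬ 2 ≤ a) =
        Multiset.replicate (p.parts.filter (fun a => ¬ 2 ≤ a)).card 1 := by
      refine Multiset.eq_replicate_card.2 fun b hb => ?_
      rw [Multiset.mem_filter] at hb
      have := p.parts_pos hb.1
      omega
    have h3 := congrArg Multiset.sum h1
    rw [Multiset.sum_add, p.parts_sum] at h3
    have h4 := congrArg Multiset.sum h2
    rw [Multiset.sum_replicate, smul_eq_mul, mul_one] at h4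
    conv_lhs => rw [← h1, h2]
    congr 2
    omega
  apply Nat.Partition.ext
  rw [key p, key q, h]

theorem aux_exists (n : ℕ) : ∃ g : Nat.Partition n → Equiv.Perm (Fin n),
    ∀ p, (g p).cycleType = p.parts.filter (fun a => 2 ≤ a) := by
  have : ∀ p : Nat.Partition n, ∃ s : Equiv.Perm (Fin n),
      s.cycleType = p.parts.filter (fun a => 2 ≤ a) := by
    intro p
    rw [Equiv.Perm.exists_with_cycleType_iff]
    refine ⟨?_, fun a ha => (Multiset.mem_filter.1 ha).2⟩
    have h3 := congrArg Multiset.sum (Multiset.filter_add_not (fun a => 2 ≤ a) p.parts)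
    rw [Multiset.sum_add, p.parts_sum] at h3
    rw [Fintype.card_fin]
    omega
  exact ⟨fun p => (this p).choose, fun p => (this p).choose_spec⟩

theorem aux_surj (n : ℕ) (s : Equiv.Perm (Fin n)) : ∃ p : Nat.Partition n,
    s.cycleType = p.parts.filter (fun a => 2 ≤ a) := by
  have h := Equiv.Perm.filter_parts_partition_eq_cycleType (σ := s)
  generalize s.partition = q at h
  have hc : Fintype.card (Fin n) = n := Fintype.card_fin n
  exact ⟨⟨q.parts, q.parts_pos, q.parts_sum.trans hc⟩, h.symm⟩

/-- exponent of the monomial attached to an index function. -/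
noncomputable def auxExp {n d : ℕ} (σ : Equiv.Perm (Fin n)) (i : Fin n → Fin d) :
    (Fin d × Fin d) →₀ ℕ := ∑ k, Finsupp.single (i (σ k), i k) 1

theorem auxExp_apply {n d : ℕ} (σ : Equiv.Perm (Fin n)) (i : Fin n → Fin d) (a : Fin d × Fin d) :
    auxExp σ i a = (Finset.univ.filter fun k => (i (σ k), i k) = a).card := by
  classical
  rw [Finset.card_filter, auxExp, Finsupp.finsetSum_apply]
  exact Finset.sum_congr rfl fun k _ => Finsupp.single_apply

theorem aux_isConj {n d : ℕ} (σ τ : Equiv.Perm (Fin n)) (e i : Fin n → Fin d)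
    (he : Function.Injective e) (h : auxExp σ i = auxExp τ e) : IsConj σ τ := by
  classical
  have hex : ∀ k, ∃ j, e (τ j) = i (σ k) ∧ e j = i k := by
    intro k
    have h1 : auxExp σ i (i (σ k), i k) ≠ 0 := by
      rw [auxExp_apply]
      exact (Finset.card_pos.2 ⟨k, by simp⟩).ne'
    rw [h, auxExp_apply] at h1
    obtain ⟨j, hj⟩ := Finset.card_pos.1 (Nat.pos_of_ne_zero h1)
    exact ⟨j, by simpa using hj⟩
  choose c hc1 hc2 using hex
  have hsurj : Function.Surjective c := by
    intro j
    have h1 : auxExp τ e (e (τ j), e j) ≠ 0 := by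
      rw [auxExp_apply]
      exact (Finset.card_pos.2 ⟨j, by simp⟩).ne'
    rw [← h, auxExp_apply] at h1
    obtain ⟨k, hk⟩ := Finset.card_pos.1 (Nat.pos_of_ne_zero h1)
    simp only [Finset.mem_filter, Finset.mem_univ, true_and, Prod.mk.injEq] at hk
    exact ⟨k, he (by rw [hc2, hk.2])⟩
  have hbij : Function.Bijective c := Finite.surjective_iff_bijective.1 hsurj
  refine isConj_iff.2 ⟨Equiv.ofBijective c hbij, ?_⟩
  rw [mul_inv_eq_iff_eq_mul]
  ext1 k
  apply he
  simp only [Equiv.Perm.mul_apply, Equiv.ofBijective_apply]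
  rw [hc2, hc1]

/-- the generic trace polynomial. -/
noncomputable def auxPoly (K : Type*) [Field K] {n : ℕ} (d : ℕ) (σ : Equiv.Perm (Fin n)) :
    MvPolynomial (Fin d × Fin d) K :=
  ∑ i : Fin n → Fin d, MvPolynomial.monomial (auxExp σ i) 1

theorem auxPoly_eval (K : Type*) [Field K] {n d : ℕ} (σ : Equiv.Perm (Fin n))
    (x : Fin d × Fin d → K) : MvPolynomial.eval x (auxPoly K d σ) =
      ∑ i : Fin n → Fin d, ∏ k, x (i (σ k), i k) := by
  rw [auxPoly, map_sum]
  refine Finset.sum_congr rfl fun i _ => ?_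
  rw [auxExp, MvPolynomial.monomial_sum_one, map_prod]
  refine Finset.prod_congr rfl fun k _ => ?_
  simp [MvPolynomial.eval_monomial]

theorem auxPoly_coeff (K : Type*) [Field K] {d : ℕ} [DecidableEq (Fin d × Fin d →₀ ℕ)]
    {n : ℕ} (σ : Equiv.Perm (Fin n)) (m : Fin d × Fin d →₀ ℕ) :
    MvPolynomial.coeff m (auxPoly K d σ) =
      ((Finset.univ.filter fun i : Fin n → Fin d => auxExp σ i = m).card : K) := by
  classical
  rw [auxPoly, MvPolynomial.coeff_sum, Finset.card_filter, Nat.cast_sum]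
  refine Finset.sum_congr rfl fun i _ => ?_
  rw [MvPolynomial.coeff_monomial]
  split_ifs <;> simp

end Aux

/-- for `1 ≤ n ≤ d`, the span of the functions
`A ↦ Tr(L_σ^{(n)} ∘ A^{⊗n})` on `End_K(K^d)`, for `σ ∈ S_n`, has dimension equal to the
number of partitions of `n`. -/
theorem stmt17 (K : Type*) [Field K] [CharZero K] (n d : ℕ) (hn : 1 ≤ n) (hnd : n ≤ d) :
    Module.finrank K
        ↥(Submodule.span K (Set.range fun σ : Equiv.Perm (Fin n) =>
          fun A : (Fin d → K) →ₗ[K] (Fin d → K) =>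
            LinearMap.trace K (⨂[K] _ : Fin n, (Fin d → K))
              (permMap K (Fin d → K) n σ ∘ₗ tpowMap K (Fin d → K) n A))) =
      Fintype.card (Nat.Partition n) := by
  classical
  obtain ⟨g, hg⟩ := aux_exists n
  set F : Equiv.Perm (Fin n) → ((Fin d → K) →ₗ[K] (Fin d → K)) → K := fun σ A =>
    LinearMap.trace K (⨂[K] _ : Fin n, (Fin d → K))
      (permMap K (Fin d → K) n σ ∘ₗ tpowMap K (Fin d → K) n A) with hF
  have hrange : Set.range F = Set.range (F ∘ g) := by
    apply Set.Subset.antisymm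
    · rintro _ ⟨σ, rfl⟩
      obtain ⟨p, hp⟩ := aux_surj n σ
      refine ⟨p, ?_⟩
      funext A
      simp only [hF, Function.comp_apply, aux_trace]
      exact aux_conj K n d _ _ (Equiv.Perm.isConj_iff_cycleType_eq.2 ((hg p).trans hp.symm)) _
    · rintro _ ⟨p, rfl⟩
      exact ⟨g p, rfl⟩
  rw [hrange]
  apply finrank_span_eq_card
  rw [Fintype.linearIndependent_iff]
  intro c hc q
  have hpoly : ∑ p, MvPolynomial.C (c p) * auxPoly K d (g p) = 0 := by
    apply MvPolynomial.funext
    intro x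
    have := congrFun hc (Matrix.toLin' (Matrix.of fun a b => x (a, b)))
    simp only [hF, Finset.sum_apply, Pi.smul_apply, Function.comp_apply, aux_trace,
      LinearMap.toMatrix'_toLin', Matrix.of_apply, smul_eq_mul, Pi.zero_apply] at this
    simpa [auxPoly_eval] using this
  have he : Function.Injective (Fin.castLE hnd) := Fin.castLE_injective hnd
  have h1 := congrArg (MvPolynomial.coeff (auxExp (g q) (Fin.castLE hnd))) hpoly
  rw [MvPolynomial.coeff_sum, Finset.sum_eq_single q, MvPolynomial.coeff_C_mul, auxPoly_coeff,
    MvPolynomial.coeff_zero] at h1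
  · refine (mul_eq_zero.1 h1).resolve_right ?_
    refine Nat.cast_ne_zero.2 ?_
    exact (Finset.card_pos.2 ⟨Fin.castLE hnd, by simp⟩).ne'
  · intro p _ hpq
    rw [MvPolynomial.coeff_C_mul, auxPoly_coeff, Finset.filter_false_of_mem]
    · simp
    · intro i _ hi
      apply hpq
      apply aux_filter_inj
      rw [← hg, ← hg]
      exact Equiv.Perm.isConj_iff_cycleType_eq.1 (aux_isConj _ _ _ _ he hi)
  · simp
end
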